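/- arXiv:0801.0897 — 6 statements merged into one kernel-verified Lean document; each statement's English description precedes it below -/
import Mathlib

section
/- Let I ⊆ ℝ be an open interval and let x, y, z : ℝ → ℝ be twice differentiable on I, with x(t)² + y(t)² + z(t)² constant on I (the curve lies on a sphere centered at the origin), satisfying the geodesic equation x''(t)·(y(t)z'(t) − z(t)y'(t)) + y''(t)·(z(t)x'(t) − x(t)z'(t)) + z''(t)·(x(t)y'(t) − y(t)x'(t)) = 0 for all t ∈ I. Assume moreover x(t) ≠ 0 and y(t)x'(t) − x(t)y'(t) ≠ 0 for all t ∈ I. Then there exist constants A, B ∈ ℝ such that A·y(t) − B·x(t) − z(t) = 0 for all t ∈ I; that is, the curve lies in a plane through the center of the sphere, so shortest lines on a sphere are arcs of great circles. -/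
/-- The derivative of the Wronskian of two twice differentiable functions. -/
theorem hasDerivAt_wronskian {u v : ℝ → ℝ} {t : ℝ}
    (hu : DifferentiableAt ℝ u t) (hu' : DifferentiableAt ℝ (deriv u) t)
    (hv : DifferentiableAt ℝ v t) (hv' : DifferentiableAt ℝ (deriv v) t) :
    HasDerivAt (fun s => u s * deriv v s - v s * deriv u s)
      (u t * deriv (deriv v) t - v t * deriv (deriv u) t) t := by
  refine ((hu.hasDerivAt.fun_mul hv'.hasDerivAt).fun_sub
    (hv.hasDerivAt.fun_mul hu'.hasDerivAt)).congr_deriv ?_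
  ring

/-- If the quotient `f / g` has zero derivative on an open interval where `g` does not vanish,
then `f` is a constant multiple of `g` there. -/
theorem exists_eq_const_mul_of_hasDerivAt {a b : ℝ} {f g f' g' : ℝ → ℝ}
    (hf : ∀ t ∈ Set.Ioo a b, HasDerivAt f (f' t) t)
    (hg : ∀ t ∈ Set.Ioo a b, HasDerivAt g (g' t) t)
    (hg0 : ∀ t ∈ Set.Ioo a b, g t ≠ 0)
    (h : ∀ t ∈ Set.Ioo a b, f' t * g t - f t * g' t = 0) :
    ∃ c : ℝ, ∀ t ∈ Set.Ioo a b, f t = c * g t := by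
  have hq : ∀ t ∈ Set.Ioo a b, HasDerivAt (fun s => f s / g s) 0 t := fun t ht => by
    simpa [h t ht] using (hf t ht).fun_div (hg t ht) (hg0 t ht)
  obtain ⟨c, hc⟩ := isOpen_Ioo.exists_is_const_of_deriv_eq_zero isPreconnected_Ioo
    (fun t ht => (hq t ht).differentiableAt.differentiableWithinAt)
    (fun t ht => (hq t ht).deriv)
  exact ⟨c, fun t ht => (div_eq_iff (hg0 t ht)).mp (hc t ht)⟩

/-- Shortest lines on a sphere lie in planes through the center (great circles). -/
theorem sphere_geodesic_is_great_circle (a b : ℝ) (x y z : ℝ → ℝ)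
    (hx : ∀ t ∈ Set.Ioo a b, DifferentiableAt ℝ x t)
    (hx' : ∀ t ∈ Set.Ioo a b, DifferentiableAt ℝ (deriv x) t)
    (hy : ∀ t ∈ Set.Ioo a b, DifferentiableAt ℝ y t)
    (hy' : ∀ t ∈ Set.Ioo a b, DifferentiableAt ℝ (deriv y) t)
    (hz : ∀ t ∈ Set.Ioo a b, DifferentiableAt ℝ z t)
    (hz' : ∀ t ∈ Set.Ioo a b, DifferentiableAt ℝ (deriv z) t)
    (hsphere : ∃ c : ℝ, ∀ t ∈ Set.Ioo a b, x t ^ 2 + y t ^ 2 + z t ^ 2 = c)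
    (hgeo : ∀ t ∈ Set.Ioo a b,
      deriv (deriv x) t * (y t * deriv z t - z t * deriv y t)
        + deriv (deriv y) t * (z t * deriv x t - x t * deriv z t)
        + deriv (deriv z) t * (x t * deriv y t - y t * deriv x t) = 0)
    (hx0 : ∀ t ∈ Set.Ioo a b, x t ≠ 0)
    (hW : ∀ t ∈ Set.Ioo a b, y t * deriv x t - x t * deriv y t ≠ 0) :
    ∃ A B : ℝ, ∀ t ∈ Set.Ioo a b, A * y t - B * x t - z t = 0 := by
  have hWd := fun t ht => hasDerivAt_wronskian (hy t ht) (hy' t ht) (hx t ht) (hx' t ht)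
  obtain ⟨A, hA⟩ := exists_eq_const_mul_of_hasDerivAt
    (fun t ht => hasDerivAt_wronskian (hz t ht) (hz' t ht) (hx t ht) (hx' t ht)) hWd hW
    (fun t ht => by linear_combination x t * hgeo t ht)
  obtain ⟨B, hB⟩ := exists_eq_const_mul_of_hasDerivAt
    (fun t ht => hasDerivAt_wronskian (hz t ht) (hz' t ht) (hy t ht) (hy' t ht)) hWd hW
    (fun t ht => by linear_combination y t * hgeo t ht)
  refine ⟨A, B, fun t ht => (mul_eq_zero.mp ?_).resolve_right (hW t ht)⟩
  linear_combination x t * hB t ht - y t * hA t ht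
end

section
/- Let x, y, z : ℝ → ℝ be twice differentiable at a point t with y(t)x'(t) − x(t)y'(t) ≠ 0. Then the function Π(t) = (z(t)x'(t) − x(t)z'(t)) / (y(t)x'(t) − x(t)y'(t)) is differentiable at t with derivative Π'(t) = x(t) · ( x(t)(y'(t)z''(t) − z'(t)y''(t)) + y(t)(z'(t)x''(t) − x'(t)z''(t)) + z(t)(x'(t)y''(t) − y'(t)x''(t)) ) / (y(t)x'(t) − x(t)y'(t))². -/
/-- The derivative of Π = (z dx − x dz)/(y dx − x dy) is x(fx + gy + hz)/(y dx − x dy)². -/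
theorem deriv_Pi (x y z : ℝ → ℝ) (t : ℝ)
    (hx : DifferentiableAt ℝ x t) (hx' : DifferentiableAt ℝ (deriv x) t)
    (hy : DifferentiableAt ℝ y t) (hy' : DifferentiableAt ℝ (deriv y) t)
    (hz : DifferentiableAt ℝ z t) (hz' : DifferentiableAt ℝ (deriv z) t)
    (hW : y t * deriv x t - x t * deriv y t ≠ 0) :
    HasDerivAt (fun s => (z s * deriv x s - x s * deriv z s) /
        (y s * deriv x s - x s * deriv y s))
      (x t * (x t * (deriv y t * deriv (deriv z) t - deriv z t * deriv (deriv y) t)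
          + y t * (deriv z t * deriv (deriv x) t - deriv x t * deriv (deriv z) t)
          + z t * (deriv x t * deriv (deriv y) t - deriv y t * deriv (deriv x) t))
        / (y t * deriv x t - x t * deriv y t) ^ 2) t := by
  have hN := (hz.hasDerivAt.fun_mul hx'.hasDerivAt).fun_sub (hx.hasDerivAt.fun_mul hz'.hasDerivAt)
  have hD := (hy.hasDerivAt.fun_mul hx'.hasDerivAt).fun_sub (hx.hasDerivAt.fun_mul hy'.hasDerivAt)
  refine (hN.fun_div hD hW).congr_deriv ?_
  congr 1
  ring
end

section
/- Let I ⊆ ℝ be an open interval and let f, g, p : ℝ → ℝ be differentiable on I. Define Z(t) = √(1 + p(t)² + (f(t) + g(t)p(t))²) and S(t) = p(t) + g(t)(f(t) + g(t)p(t)). If at a point t ∈ I the Euler–Lagrange equation g'(t)·(f(t) + g(t)p(t))/Z(t) = (S/Z)'(t) holds, then p'(t)·(1 + f(t)² + g(t)²) + (g(t) − f(t)p(t))·(f'(t) + p(t)g'(t)) = 0. -/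
/-- Expanding the Euler–Lagrange equation dg(f+gp)/Z = d((p+g(f+gp))/Z) yields
    dp(1+f²+g²) + (g−fp)(df+p dg) = 0. -/
theorem euler_lagrange_expanded (a b : ℝ) (f g p : ℝ → ℝ)
    (hf : ∀ t ∈ Set.Ioo a b, DifferentiableAt ℝ f t)
    (hg : ∀ t ∈ Set.Ioo a b, DifferentiableAt ℝ g t)
    (hp : ∀ t ∈ Set.Ioo a b, DifferentiableAt ℝ p t)
    (t : ℝ) (ht : t ∈ Set.Ioo a b)
    (hEL : deriv g t * (f t + g t * p t) /
        Real.sqrt (1 + p t ^ 2 + (f t + g t * p t) ^ 2) =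
      deriv (fun s => (p s + g s * (f s + g s * p s)) /
        Real.sqrt (1 + p s ^ 2 + (f s + g s * p s) ^ 2)) t) :
    deriv p t * (1 + f t ^ 2 + g t ^ 2)
      + (g t - f t * p t) * (deriv f t + p t * deriv g t) = 0 := by
  have hf' := (hf t ht).hasDerivAt
  have hg' := (hg t ht).hasDerivAt
  have hp' := (hp t ht).hasDerivAt
  have hW : 0 < 1 + p t ^ 2 + (f t + g t * p t) ^ 2 := by positivity
  have hu : HasDerivAt (fun s => f s + g s * p s)
      (deriv f t + (deriv g t * p t + g t * deriv p t)) t := hf'.add (hg'.mul hp')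
  have hZ := (((hp'.fun_pow 2).const_add 1).fun_add (hu.fun_pow 2)).sqrt hW.ne'
  have hS := hp'.fun_add (hg'.fun_mul hu)
  have hZpos := Real.sqrt_pos.mpr hW
  have hZsq := Real.sq_sqrt hW.le
  rw [(hS.fun_div hZ hZpos.ne').deriv] at hEL
  set Z := Real.sqrt (1 + p t ^ 2 + (f t + g t * p t) ^ 2)
  field_simp at hEL
  rw [hZsq] at hEL
  norm_num at hEL
  linear_combination -hEL / 2
end

section
/- Let I ⊆ ℝ be an open interval and let v, h, k : ℝ → ℝ be differentiable on I, and suppose that at every t ∈ I the equation 0 = −v'(t)·(1 + h(t)²) + v(t)·h(t)·h'(t) + (1 + h(t)² + v(t)²)·k'(t)/(1 + k(t)²) holds. Define s(t) = v(t)/√(1 + h(t)²). Then s is differentiable on I and s'(t)/(1 + s(t)²) = k'(t)/((1 + k(t)²)·√(1 + h(t)²)) for all t ∈ I. -/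
/-- The derivative of `v / √(1 + h²)`. -/
theorem HasDerivAt.div_sqrt_one_add_sq {v h : ℝ → ℝ} {v' h' t : ℝ}
    (hv : HasDerivAt v v' t) (hh : HasDerivAt h h' t) :
    HasDerivAt (fun τ => v τ / Real.sqrt (1 + h τ ^ 2))
      ((v' * (1 + h t ^ 2) - v t * h t * h') / Real.sqrt (1 + h t ^ 2) ^ 3) t := by
  have hpos : 0 < 1 + h t ^ 2 := by positivity
  have hr : 0 < Real.sqrt (1 + h t ^ 2) := Real.sqrt_pos.mpr hpos
  have hsq : Real.sqrt (1 + h t ^ 2) ^ 2 = 1 + h t ^ 2 := Real.sq_sqrt hpos.le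
  refine (hv.fun_div (((hh.fun_pow 2).const_add 1).sqrt hpos.ne') hr.ne').congr_deriv ?_
  generalize Real.sqrt (1 + h t ^ 2) = r at hr hsq ⊢
  rw [← hsq]
  field_simp
  push_cast
  ring

/-- The substitution s = v/√(1+h²) separates the variables in
    0 = −dv(1+h²) + vh dh + (1+h²+v²) dk/(1+k²). -/
theorem separation_s (a b : ℝ) (v h k : ℝ → ℝ)
    (hv : ∀ t ∈ Set.Ioo a b, DifferentiableAt ℝ v t)
    (hh : ∀ t ∈ Set.Ioo a b, DifferentiableAt ℝ h t)
    (hk : ∀ t ∈ Set.Ioo a b, DifferentiableAt ℝ k t)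
    (heq : ∀ t ∈ Set.Ioo a b,
      0 = -deriv v t * (1 + h t ^ 2) + v t * h t * deriv h t
        + (1 + h t ^ 2 + v t ^ 2) * deriv k t / (1 + k t ^ 2)) :
    (∀ t ∈ Set.Ioo a b,
      DifferentiableAt ℝ (fun τ => v τ / Real.sqrt (1 + h τ ^ 2)) t) ∧
    ∀ t ∈ Set.Ioo a b,
      deriv (fun τ => v τ / Real.sqrt (1 + h τ ^ 2)) t
          / (1 + (v t / Real.sqrt (1 + h t ^ 2)) ^ 2) =
        deriv k t / ((1 + k t ^ 2) * Real.sqrt (1 + h t ^ 2)) := by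
  have hs : ∀ t ∈ Set.Ioo a b, HasDerivAt (fun τ => v τ / Real.sqrt (1 + h τ ^ 2)) _ t :=
    fun t ht => (hv t ht).hasDerivAt.div_sqrt_one_add_sq (hh t ht).hasDerivAt
  refine ⟨fun t ht => (hs t ht).differentiableAt, fun t ht => ?_⟩
  have hpos : 0 < 1 + h t ^ 2 := by positivity
  have hr : 0 < Real.sqrt (1 + h t ^ 2) := Real.sqrt_pos.mpr hpos
  have hsq : Real.sqrt (1 + h t ^ 2) ^ 2 = 1 + h t ^ 2 := Real.sq_sqrt hpos.le
  have hk₀ : 0 < 1 + k t ^ 2 := by positivity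
  have hnum : deriv v t * (1 + h t ^ 2) - v t * h t * deriv h t =
      (1 + h t ^ 2 + v t ^ 2) * deriv k t / (1 + k t ^ 2) := by
    linarith [heq t ht]
  rw [(hs t ht).deriv, hnum]
  generalize Real.sqrt (1 + h t ^ 2) = r at hr hsq ⊢
  rw [← hsq]
  have hsum : 0 < r ^ 2 + v t ^ 2 := by positivity
  field_simp
end

section
/- Let n = (p, q, r) and T = (x', y', z') and A = (x'', y'', z'') be vectors in ℝ³ with p·x' + q·y' + r·z' = 0, with x''·(q·z' − r·y') + y''·(r·x' − p·z') + z''·(p·y' − q·x') = 0, and with (q·z' − r·y', r·x' − p·z', p·y' − q·x') ≠ (0,0,0). Then (x'·x'' + y'·y'' + z'·z'')·(q·z' − r·y') = (x'² + y'² + z'²)·(q·z'' − r·y''), and likewise with (q z'−r y', q z''−r y'') replaced by (r x'−p z', r x''−p z'') or by (p y'−q x', p y''−q x''). -/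
/-- Euler's relations dds/ds = (q ddz − r ddy)/(q dz − r dy) = ⋯ for a shortest line. -/
theorem dds_over_ds (p q r x' y' z' x'' y'' z'' : ℝ)
    (horth : p * x' + q * y' + r * z' = 0)
    (hgeo : x'' * (q * z' - r * y') + y'' * (r * x' - p * z')
        + z'' * (p * y' - q * x') = 0)
    (hne : (q * z' - r * y', r * x' - p * z', p * y' - q * x')
        ≠ ((0 : ℝ), (0 : ℝ), (0 : ℝ))) :
    (x' * x'' + y' * y'' + z' * z'') * (q * z' - r * y') =
        (x' ^ 2 + y' ^ 2 + z' ^ 2) * (q * z'' - r * y'') ∧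
    (x' * x'' + y' * y'' + z' * z'') * (r * x' - p * z') =
        (x' ^ 2 + y' ^ 2 + z' ^ 2) * (r * x'' - p * z'') ∧
    (x' * x'' + y' * y'' + z' * z'') * (p * y' - q * x') =
        (x' ^ 2 + y' ^ 2 + z' ^ 2) * (p * y'' - q * x'') := by
  refine ⟨?_, ?_, ?_⟩
  -- With `n = (p, q, r)`, the two sides differ by
  -- `n × (T × (T × A)) = (n · (T × A)) T - (n · T) (T × A)`.
  · linear_combination x' * hgeo - (y' * z'' - z' * y'') * horth
  · linear_combination y' * hgeo - (z' * x'' - x' * z'') * horth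
  · linear_combination z' * hgeo - (x' * y'' - y' * x'') * horth
end

section
/- Let I ⊆ ℝ be an open interval and let u, v, t, w : ℝ → ℝ be differentiable on I with v(τ) = w(τ)·√(1 + t(τ)²) for all τ ∈ I. If at every τ ∈ I the equation (u'(τ)/(1 + u(τ)²))·(1 + v(τ)² + t(τ)²) − v'(τ)·(1 + t(τ)²) + v(τ)·t(τ)·t'(τ) = 0 holds, then w'(τ)/(1 + w(τ)²) = u'(τ)/((1 + u(τ)²)·√(1 + t(τ)²)) for all τ ∈ I. -/
/-- The substitution v = w√(1+t²) separates the variables in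
    (du/(1+u²))(1+v²+t²) − dv(1+t²) + vt dt = 0. -/
theorem separation_w (a b : ℝ) (u v t w : ℝ → ℝ)
    (hu : ∀ τ ∈ Set.Ioo a b, DifferentiableAt ℝ u τ)
    (hv : ∀ τ ∈ Set.Ioo a b, DifferentiableAt ℝ v τ)
    (ht : ∀ τ ∈ Set.Ioo a b, DifferentiableAt ℝ t τ)
    (hw : ∀ τ ∈ Set.Ioo a b, DifferentiableAt ℝ w τ)
    (hvw : ∀ τ ∈ Set.Ioo a b, v τ = w τ * Real.sqrt (1 + t τ ^ 2))
    (heq : ∀ τ ∈ Set.Ioo a b,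
      deriv u τ / (1 + u τ ^ 2) * (1 + v τ ^ 2 + t τ ^ 2)
        - deriv v τ * (1 + t τ ^ 2) + v τ * t τ * deriv t τ = 0) :
    ∀ τ ∈ Set.Ioo a b,
      deriv w τ / (1 + w τ ^ 2) =
        deriv u τ / ((1 + u τ ^ 2) * Real.sqrt (1 + t τ ^ 2)) := by
  intro τ hτ
  have hpos : 0 < 1 + t τ ^ 2 := by positivity
  have hderiv : deriv v τ = deriv w τ * √(1 + t τ ^ 2) +
      w τ * (t τ * deriv t τ / √(1 + t τ ^ 2)) := by
    have hinner : HasDerivAt (fun x => 1 + t x ^ 2) (2 * t τ * deriv t τ) τ := by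
      simpa using ((ht τ hτ).hasDerivAt.pow 2).const_add 1
    have hprod := (hw τ hτ).hasDerivAt.mul (hinner.sqrt hpos.ne')
    have hev : v =ᶠ[nhds τ] w * fun x => √(1 + t x ^ 2) :=
      Filter.eventuallyEq_of_mem (isOpen_Ioo.mem_nhds hτ) hvw
    rw [(hprod.congr_of_eventuallyEq hev).deriv]
    field_simp
  have hspos : 0 < √(1 + t τ ^ 2) := Real.sqrt_pos.2 hpos
  have hsq : √(1 + t τ ^ 2) ^ 2 = 1 + t τ ^ 2 := Real.sq_sqrt hpos.le
  have hode := heq τ hτ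
  rw [hderiv, hvw τ hτ] at hode
  generalize √(1 + t τ ^ 2) = s at *
  have hw_pos : 0 < 1 + w τ ^ 2 := by positivity
  rw [← div_div, div_eq_div_iff hw_pos.ne' hspos.ne']
  generalize deriv u τ / (1 + u τ ^ 2) = U at *
  have hfactor : s ^ 2 * (U * (1 + w τ ^ 2) - deriv w τ * s) = 0 := by
    have hsum : 1 + (w τ * s) ^ 2 + t τ ^ 2 = s ^ 2 * (1 + w τ ^ 2) := by
      linear_combination -hsq
    rw [hsum, ← hsq] at hode
    rw [← hode]
    field_simp
    ring
  have hzero := (mul_eq_zero.1 hfactor).resolve_left (by positivity)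
  linarith
end
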